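/- arXiv:2501.01970 — 4 statements merged into one kernel-verified Lean document; each statement's English description precedes it below -/
import Mathlib

section
/- Let n ≥ 2 be a natural number, let t₀ ≥ 2 be a real number, and let f : ℝ → ℝ be the cut-off function f(t) = min(t, min(1, t₀ − t)). Let g : ℝ → ℝ be continuous, and suppose there are constants c₁, c₂ ≥ 0 with |g(t)| ≤ c₁ for all t ∈ [0,1] and |g(t)| ≤ c₂ for all t ∈ [t₀−1, t₀]. If ∫₀^{t₀} f(t)² g(t) dt ≤ 2(n−1), then ∫₀^{t₀} g(t) dt ≤ 2(n−1) + (2/3)(c₁ + c₂). -/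
theorem integral_one_sub_sq_mul_const (c : ℝ) :
    ∫ t in (0 : ℝ)..1, (1 - t ^ 2) * c = 2 / 3 * c := by
  rw [intervalIntegral.integral_mul_const, intervalIntegral.integral_sub
    intervalIntegrable_const (Continuous.intervalIntegrable (by fun_prop) _ _), integral_pow]
  norm_num

theorem one_sub_sq_mul_le {x y c : ℝ} (hx : 0 ≤ x) (hx1 : x ≤ 1) (hy : |y| ≤ c) :
    (1 - x ^ 2) * y ≤ (1 - x ^ 2) * c :=
  mul_le_mul_of_nonneg_left ((le_abs_self y).trans hy) (by nlinarith)

/-- Integrated curvature estimate: if `∫₀^{t₀} f² g ≤ 2(n-1)` for the cut-off `f`, and `g`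
is continuous with `|g| ≤ c₁` on `[0,1]` and `|g| ≤ c₂` on `[t₀-1,t₀]`, then
`∫₀^{t₀} g ≤ 2(n-1) + (2/3)(c₁ + c₂)`. -/
theorem integrated_curvature_estimate (n : ℕ) (hn : 2 ≤ n) (t₀ : ℝ) (ht₀ : 2 ≤ t₀)
    (f : ℝ → ℝ) (hf : ∀ t, f t = min t (min 1 (t₀ - t)))
    (g : ℝ → ℝ) (hg : Continuous g)
    (c₁ c₂ : ℝ) (hc₁ : 0 ≤ c₁) (hc₂ : 0 ≤ c₂)
    (hg₁ : ∀ t ∈ Set.Icc (0 : ℝ) 1, |g t| ≤ c₁)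
    (hg₂ : ∀ t ∈ Set.Icc (t₀ - 1) t₀, |g t| ≤ c₂)
    (hint : ∫ t in (0 : ℝ)..t₀, f t ^ 2 * g t ≤ 2 * ((n : ℝ) - 1)) :
    ∫ t in (0 : ℝ)..t₀, g t ≤ 2 * ((n : ℝ) - 1) + 2 / 3 * (c₁ + c₂) := by
  have hfc : Continuous f := by
    rw [funext hf]
    fun_prop
  have hhc : Continuous fun t => (1 - f t ^ 2) * g t := by fun_prop
  have hii (a b : ℝ) : IntervalIntegrable (fun t => (1 - f t ^ 2) * g t) MeasureTheory.volume a b :=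
    hhc.intervalIntegrable a b
  have hsplit : ∫ t in (0 : ℝ)..t₀, g t =
      (∫ t in (0 : ℝ)..t₀, f t ^ 2 * g t) + ∫ t in (0 : ℝ)..t₀, (1 - f t ^ 2) * g t := by
    rw [← intervalIntegral.integral_add (Continuous.intervalIntegrable (by fun_prop) _ _) (hii _ _)]
    congr 1
    ext t
    ring
  have hleft : ∫ t in (0 : ℝ)..1, (1 - f t ^ 2) * g t ≤ 2 / 3 * c₁ := by
    rw [← integral_one_sub_sq_mul_const]
    refine intervalIntegral.integral_mono_on zero_le_one (hii _ _)
      (Continuous.intervalIntegrable (by fun_prop) _ _) fun t ht => ?_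
    have hft : f t = t := by
      rw [hf, min_eq_left (le_min ht.2 (by linarith [ht.2]))]
    rw [hft]
    exact one_sub_sq_mul_le ht.1 ht.2 (hg₁ t ht)
  have hmid : ∫ t in (1 : ℝ)..(t₀ - 1), (1 - f t ^ 2) * g t = 0 := by
    refine (intervalIntegral.integral_congr fun t ht => ?_).trans intervalIntegral.integral_zero
    rw [Set.uIcc_of_le (by linarith)] at ht
    have hft : f t = 1 := by
      rw [hf, min_eq_left (by linarith [ht.2] : (1 : ℝ) ≤ t₀ - t), min_eq_right ht.1]
    simp [hft]
  have hright : ∫ t in (t₀ - 1)..t₀, (1 - f t ^ 2) * g t ≤ 2 / 3 * c₂ := by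
    have hsub : ∫ t in (t₀ - 1)..t₀, (1 - (t₀ - t) ^ 2) * c₂ = 2 / 3 * c₂ := by
      rw [intervalIntegral.integral_comp_sub_left (fun t => (1 - t ^ 2) * c₂) t₀, sub_self,
        sub_sub_cancel, integral_one_sub_sq_mul_const]
    rw [← hsub]
    refine intervalIntegral.integral_mono_on (by linarith) (hii _ _)
      (Continuous.intervalIntegrable (by fun_prop) _ _) fun t ht => ?_
    have hft : f t = t₀ - t := by
      rw [hf, min_eq_right (by linarith [ht.1] : t₀ - t ≤ 1), min_eq_right (by linarith [ht.1])]
    rw [hft]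
    exact one_sub_sq_mul_le (by linarith [ht.2]) (by linarith [ht.1]) (hg₂ t ht)
  rw [hsplit, ← intervalIntegral.integral_add_adjacent_intervals (hii 0 (t₀ - 1)) (hii _ _),
    ← intervalIntegral.integral_add_adjacent_intervals (hii 0 1) (hii _ _), hmid]
  linarith
end

section
/- Let n ≥ 2 be a natural number, let t₀ ≥ 2 and c ≥ 0 be real numbers, and let f : ℝ → ℝ be the cut-off function f(t) = min(t, min(1, t₀ − t)). Let g : ℝ → ℝ be continuous with |g(t)| ≤ c for all t ∈ [0,1] ∪ [t₀−1, t₀], and suppose ∫₀^{t₀} f(t)² g(t) dt ≤ 2(n−1). Let u : ℝ → ℝ be differentiable on [0, t₀] with u′(t) ≥ 1/2 − g(t) for every t ∈ [0, t₀]. Then u(t₀) ≥ u(0) + t₀/2 − 2(n−1) − 4c/3. -/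
/-- The complement `1 - f²` of the squared trapezoidal cut-off has integral `4/3`. -/
theorem integral_one_sub_sq_cutoff {T : ℝ} (hT : 2 ≤ T) :
    ∫ t in (0 : ℝ)..T, (1 - min t (min 1 (T - t)) ^ 2) = 4 / 3 := by
  have hcont : Continuous fun t : ℝ => 1 - min t (min 1 (T - t)) ^ 2 := by fun_prop
  have hleft : ∫ t in (0 : ℝ)..1, (1 - min t (min 1 (T - t)) ^ 2) = 2 / 3 := by
    have hcongr : ∫ t in (0 : ℝ)..1, (1 - min t (min 1 (T - t)) ^ 2)
        = ∫ t in (0 : ℝ)..1, (1 - t ^ 2) := by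
      refine intervalIntegral.integral_congr fun t ht => ?_
      rw [Set.uIcc_of_le zero_le_one] at ht
      have h : min t (min 1 (T - t)) = t :=
        min_eq_left (le_min ht.2 (by linarith [ht.2]))
      simp only [h]
    rw [hcongr, intervalIntegral.integral_sub (by simp) (by simp)]
    norm_num
  have hmid : ∫ t in (1 : ℝ)..(T - 1), (1 - min t (min 1 (T - t)) ^ 2) = 0 := by
    have hcongr : ∫ t in (1 : ℝ)..(T - 1), (1 - min t (min 1 (T - t)) ^ 2)
        = ∫ _ in (1 : ℝ)..(T - 1), (0 : ℝ) := by
      refine intervalIntegral.integral_congr fun t ht => ?_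
      rw [Set.uIcc_of_le (by linarith)] at ht
      have h : min t (min 1 (T - t)) = 1 := by
        rw [min_eq_left (by linarith [ht.2] : 1 ≤ T - t), min_eq_right ht.1]
      simp only [h]
      norm_num
    rw [hcongr, intervalIntegral.integral_zero]
  have hright : ∫ t in (T - 1)..T, (1 - min t (min 1 (T - t)) ^ 2) = 2 / 3 := by
    have hreflect := intervalIntegral.integral_comp_sub_left (a := (0 : ℝ)) (b := 1)
      (fun t : ℝ => 1 - min t (min 1 (T - t)) ^ 2) T
    rw [sub_zero] at hreflect
    rw [← hreflect, ← hleft]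
    refine intervalIntegral.integral_congr fun t _ => ?_
    have h : min (T - t) (min 1 (T - (T - t))) = min t (min 1 (T - t)) := by
      rw [sub_sub_cancel, min_left_comm, min_comm (T - t), min_left_comm]
    simp only [h]
  rw [← intervalIntegral.integral_add_adjacent_intervals (hcont.intervalIntegrable 0 (T - 1))
      (hcont.intervalIntegrable (T - 1) T),
    ← intervalIntegral.integral_add_adjacent_intervals (hcont.intervalIntegrable 0 1)
      (hcont.intervalIntegrable 1 (T - 1)), hleft, hmid, hright]
  norm_num

/-- A function whose derivative is bounded below by a continuous function grows at least by the
integral of that function. -/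
theorem integral_le_sub_of_le_hasDerivAt {a b : ℝ} (hab : a ≤ b) {u u' φ : ℝ → ℝ}
    (hφ : Continuous φ) (hu : ∀ t ∈ Set.Icc a b, HasDerivAt u (u' t) t)
    (hle : ∀ t ∈ Set.Icc a b, φ t ≤ u' t) :
    ∫ t in a..b, φ t ≤ u b - u a := by
  have hderiv : ∀ t ∈ Set.Icc a b,
      HasDerivAt (fun s => u s - ∫ x in a..s, φ x) (u' t - φ t) t := fun t ht =>
    (hu t ht).sub (hφ.integral_hasStrictDerivAt a t).hasDerivAt
  have hmono : MonotoneOn (fun s => u s - ∫ x in a..s, φ x) (Set.Icc a b) := by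
    refine monotoneOn_of_hasDerivWithinAt_nonneg (convex_Icc a b)
      (fun t ht => (hderiv t ht).continuousAt.continuousWithinAt)
      (fun t ht => (hderiv t (interior_subset ht)).hasDerivWithinAt)
      (fun t ht => sub_nonneg.2 (hle t (interior_subset ht)))
  have h := hmono (Set.left_mem_Icc.2 hab) (Set.right_mem_Icc.2 hab) hab
  simp only [intervalIntegral.integral_same] at h
  linarith

/-- Analytic core of Theorem 1.1 along a single geodesic: under the index-form inequality and
the endpoint bound `|g| ≤ c`, the S-curvature `u` with `u' ≥ 1/2 - g` satisfies
`u t₀ ≥ u 0 + t₀/2 - 2(n-1) - 4c/3`. -/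
theorem scurvature_linear_lower_bound (n : ℕ) (hn : 2 ≤ n) (t₀ c : ℝ) (ht₀ : 2 ≤ t₀)
    (hc : 0 ≤ c)
    (f : ℝ → ℝ) (hf : ∀ t, f t = min t (min 1 (t₀ - t)))
    (g : ℝ → ℝ) (hg : Continuous g)
    (hgbd : ∀ t ∈ Set.Icc (0 : ℝ) 1 ∪ Set.Icc (t₀ - 1) t₀, |g t| ≤ c)
    (hint : ∫ t in (0 : ℝ)..t₀, f t ^ 2 * g t ≤ 2 * ((n : ℝ) - 1))
    (u u' : ℝ → ℝ)
    (hu : ∀ t ∈ Set.Icc (0 : ℝ) t₀, HasDerivAt u (u' t) t)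
    (hu' : ∀ t ∈ Set.Icc (0 : ℝ) t₀, u' t ≥ 1 / 2 - g t) :
    u t₀ ≥ u 0 + t₀ / 2 - 2 * ((n : ℝ) - 1) - 4 * c / 3 := by
  obtain rfl : f = fun t => min t (min 1 (t₀ - t)) := funext hf
  have h0 : (0 : ℝ) ≤ t₀ := by linarith
  have hgrowth := integral_le_sub_of_le_hasDerivAt h0 (by fun_prop) hu hu'
  have hhalf : ∫ t in (0 : ℝ)..t₀, (1 / 2 - g t) = t₀ / 2 - ∫ t in (0 : ℝ)..t₀, g t := by
    rw [intervalIntegral.integral_sub (by simp) (hg.intervalIntegrable _ _),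
      intervalIntegral.integral_const, smul_eq_mul]
    ring
  have hpointwise : ∀ t ∈ Set.Icc (0 : ℝ) t₀,
      g t ≤ min t (min 1 (t₀ - t)) ^ 2 * g t + c * (1 - min t (min 1 (t₀ - t)) ^ 2) := by
    intro t ht
    have hnonneg : 0 ≤ min t (min 1 (t₀ - t)) :=
      le_min ht.1 (le_min zero_le_one (sub_nonneg.2 ht.2))
    have hle_one : min t (min 1 (t₀ - t)) ≤ 1 := (min_le_right _ _).trans (min_le_left _ _)
    by_cases hend : t ∈ Set.Icc (0 : ℝ) 1 ∪ Set.Icc (t₀ - 1) t₀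
    · have hgc : g t ≤ c := (le_abs_self _).trans (hgbd t hend)
      have hsq : min t (min 1 (t₀ - t)) ^ 2 ≤ 1 := pow_le_one₀ hnonneg hle_one
      linarith [mul_nonneg (sub_nonneg.2 hsq) (sub_nonneg.2 hgc)]
    · have h1 : 1 ≤ t := by
        by_contra! h
        exact hend (Or.inl ⟨ht.1, h.le⟩)
      have h2 : t ≤ t₀ - 1 := by
        by_contra! h
        exact hend (Or.inr ⟨h.le, ht.2⟩)
      rw [min_eq_left (by linarith : 1 ≤ t₀ - t), min_eq_right h1]
      linarith
  have hsplit := intervalIntegral.integral_mono_on (μ := MeasureTheory.volume) h0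
    (hg.intervalIntegrable _ _)
    (Continuous.intervalIntegrable (by fun_prop) _ _) hpointwise
  rw [intervalIntegral.integral_add (Continuous.intervalIntegrable (by fun_prop) _ _)
      (Continuous.intervalIntegrable (by fun_prop) _ _),
    intervalIntegral.integral_const_mul, integral_one_sub_sq_cutoff ht₀] at hsplit
  linarith
end

section
/- Let n ≥ 2 be a natural number, let t₀ ≥ 2 and c ≥ 0 be real numbers, and let f : ℝ → ℝ be the cut-off function f(t) = min(t, min(1, t₀ − t)). Let r : ℝ → ℝ be continuous with |r(t)| ≤ c for all t ∈ [0,1], and suppose ∫₀^{t₀} f(t)² r(t) dt ≤ 2(n−1). Let S : ℝ → ℝ be differentiable on [0, t₀] with S′(t) = 1/2 − r(t) for every t ∈ [0, t₀]. Then there exists t* ∈ [t₀−1, t₀] with |S(t*)| ≥ t₀/2 − 2n + 7/6 − c/3 + S(1). -/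
/-- If `g' ≤ φ` on `[a, b]` and `φ` is continuous, then `g b - g a ≤ ∫ φ` over `[a, b]`. -/
theorem sub_le_intervalIntegral_of_hasDerivAt_le {a b : ℝ} {g g' φ : ℝ → ℝ} (hab : a ≤ b)
    (hφ : Continuous φ) (hg : ∀ t ∈ Set.Icc a b, HasDerivAt g (g' t) t)
    (hle : ∀ t ∈ Set.Icc a b, g' t ≤ φ t) :
    g b - g a ≤ ∫ t in a..b, φ t :=
  intervalIntegral.sub_le_integral_of_hasDeriv_right_of_le hab
    (fun t ht => (hg t ht).continuousAt.continuousWithinAt)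
    (fun t ht => (hg t (Set.Ioo_subset_Icc_self ht)).hasDerivWithinAt)
    hφ.continuousOn.integrableOn_Icc
    (fun t ht => hle t (Set.Ioo_subset_Icc_self ht))

/-- Analytic core of Theorem 7.2 along a single geodesic: under the index-form inequality and
the bound `|r| ≤ c` on `[0,1]`, there exists `t* ∈ [t₀-1, t₀]` with
`|S t*| ≥ t₀/2 - 2n + 7/6 - c/3 + S 1`. -/
theorem scurvature_sup_lower_bound (n : ℕ) (hn : 2 ≤ n) (t₀ c : ℝ) (ht₀ : 2 ≤ t₀)
    (hc : 0 ≤ c)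
    (f : ℝ → ℝ) (hf : ∀ t, f t = min t (min 1 (t₀ - t)))
    (r : ℝ → ℝ) (hr : Continuous r)
    (hrbd : ∀ t ∈ Set.Icc (0 : ℝ) 1, |r t| ≤ c)
    (hint : ∫ t in (0 : ℝ)..t₀, f t ^ 2 * r t ≤ 2 * ((n : ℝ) - 1))
    (S : ℝ → ℝ)
    (hS : ∀ t ∈ Set.Icc (0 : ℝ) t₀, HasDerivAt S (1 / 2 - r t) t) :
    ∃ t' ∈ Set.Icc (t₀ - 1) t₀,
      |S t'| ≥ t₀ / 2 - 2 * (n : ℝ) + 7 / 6 - c / 3 + S 1 := by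
  have hfc : Continuous fun t => f t ^ 2 * r t := by
    have hf' : f = fun t => min t (min 1 (t₀ - t)) := funext hf
    rw [hf']
    fun_prop
  obtain ⟨s, hs, hmax⟩ := (isCompact_Icc (a := t₀ - 1) (b := t₀)).exists_isMaxOn
    (Set.nonempty_Icc.2 (by linarith)) (f := fun t => |S t|)
    (fun t ht => (hS t ⟨by linarith [ht.1], ht.2⟩).continuousAt.abs.continuousWithinAt)
  refine ⟨s, hs, ?_⟩
  have initial_bound : -(c / 3) ≤ ∫ t in (0 : ℝ)..1, f t ^ 2 * r t := by
    have h := sub_le_intervalIntegral_of_hasDerivAt_le (a := 0) (b := 1)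
      (g := fun t => -(c / 3) * t ^ 3) (g' := fun t => -(c / 3) * (3 * t ^ 2))
      zero_le_one hfc
      (fun t _ => by simpa using (hasDerivAt_pow 3 t).const_mul (-(c / 3)))
      (fun t ht => by
        have hft : f t = t := by
          rw [hf, min_eq_left]
          exact le_min ht.2 (by linarith [ht.2])
        rw [hft]
        nlinarith [(abs_le.1 (hrbd t ht)).1, sq_nonneg t])
    simpa using h
  have middle_bound : (t₀ - 1) / 2 - S (t₀ - 1) - (1 / 2 - S 1) ≤
      ∫ t in (1 : ℝ)..(t₀ - 1), f t ^ 2 * r t :=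
    sub_le_intervalIntegral_of_hasDerivAt_le
      (g := fun t => t / 2 - S t) (g' := fun t => 1 / 2 - (1 / 2 - r t))
      (by linarith) hfc
      (fun t ht => ((hasDerivAt_id t).div_const 2).sub
        (hS t ⟨by linarith [ht.1], by linarith [ht.2]⟩))
      (fun t ht => by
        have hft : f t = 1 := by
          rw [hf, min_eq_left (b := t₀ - t) (by linarith [ht.2]), min_eq_right ht.1]
        rw [hft]
        linarith)
  have final_bound : 1 / 6 - |S s| + S (t₀ - 1) ≤
      ∫ t in (t₀ - 1)..t₀, f t ^ 2 * r t := by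
    have h := sub_le_intervalIntegral_of_hasDerivAt_le (a := t₀ - 1) (b := t₀)
      (g := fun t => (t₀ - t) ^ 2 * (|S s| - S t - (t₀ - t) / 6))
      (g' := fun t => 2 * (t₀ - t) * (-1) * (|S s| - S t - (t₀ - t) / 6) +
        (t₀ - t) ^ 2 * (-(1 / 2 - r t) - (-1) / 6))
      (by linarith) hfc
      (fun t ht => by
        have hlin : HasDerivAt (fun x => t₀ - x) (-1) t := (hasDerivAt_id t).const_sub t₀
        have hSt := hS t ⟨by linarith [ht.1], ht.2⟩
        exact ((hlin.pow 2).mul ((hSt.const_sub |S s|).sub (hlin.div_const 6))).congr_deriv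
          (by simp))
      (fun t ht => by
        have hft : f t = t₀ - t := by
          rw [hf, min_eq_right (a := 1) (by linarith [ht.1]), min_eq_right]
          linarith [ht.1]
        rw [hft]
        have hSt : S t ≤ |S s| := (le_abs_self _).trans (hmax ht)
        nlinarith [mul_nonneg (sub_nonneg.2 ht.2) (sub_nonneg.2 hSt)])
    ring_nf at h ⊢
    linarith
  have hii : ∀ a b : ℝ, IntervalIntegrable (fun t => f t ^ 2 * r t) MeasureTheory.volume a b :=
    fun a b => hfc.intervalIntegrable a b
  rw [← intervalIntegral.integral_add_adjacent_intervals (hii 0 1) (hii 1 t₀),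
    ← intervalIntegral.integral_add_adjacent_intervals (hii 1 (t₀ - 1)) (hii (t₀ - 1) t₀)] at hint
  linarith
end

section
/- Let n ≥ 2 be a natural number, let t₀ ≥ 2 and c ≥ 0 be real numbers, and let f : ℝ → ℝ be the cut-off function f(t) = min(t, min(1, t₀ − t)). Let r : ℝ → ℝ be continuous with |r(t)| ≤ c for all t ∈ [0,1], and suppose ∫₀^{t₀} f(t)² r(t) dt ≤ 2(n−1). Let S : ℝ → ℝ be differentiable on [0, t₀] with S′(t) = 1/2 − r(t) for every t ∈ [0, t₀]. Let χ : ℝ → ℝ satisfy χ(t) ≥ 0 and |S(t)| ≤ √(χ(t)) for all t ∈ [t₀−1, t₀], and suppose |√(χ(t)) − √(χ(t′))| ≤ (1/2)|t − t′| for all t, t′ ∈ [t₀−1, t₀]. Then √(χ(t₀)) ≥ t₀/2 − 2n + 2/3 − c/3 + S(1). -/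
/-- Distortion lower bound step in the proof of Theorem 7.2: under the S-curvature estimate
hypotheses, if `|S| ≤ √χ` on `[t₀-1, t₀]` and `√χ` is `(1/2)`-Lipschitz there, then
`√(χ t₀) ≥ t₀/2 - 2n + 2/3 - c/3 + S 1`. -/
theorem distortion_lower_bound (n : ℕ) (hn : 2 ≤ n) (t₀ c : ℝ) (ht₀ : 2 ≤ t₀)
    (hc : 0 ≤ c)
    (f : ℝ → ℝ) (hf : ∀ t, f t = min t (min 1 (t₀ - t)))
    (r : ℝ → ℝ) (hr : Continuous r)
    (hrbd : ∀ t ∈ Set.Icc (0 : ℝ) 1, |r t| ≤ c)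
    (hint : ∫ t in (0 : ℝ)..t₀, f t ^ 2 * r t ≤ 2 * ((n : ℝ) - 1))
    (S : ℝ → ℝ)
    (hS : ∀ t ∈ Set.Icc (0 : ℝ) t₀, HasDerivAt S (1 / 2 - r t) t)
    (χ : ℝ → ℝ)
    (hχnn : ∀ t ∈ Set.Icc (t₀ - 1) t₀, 0 ≤ χ t)
    (hSχ : ∀ t ∈ Set.Icc (t₀ - 1) t₀, |S t| ≤ Real.sqrt (χ t))
    (hχlip : ∀ t ∈ Set.Icc (t₀ - 1) t₀, ∀ t' ∈ Set.Icc (t₀ - 1) t₀,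
      |Real.sqrt (χ t) - Real.sqrt (χ t')| ≤ 1 / 2 * |t - t'|) :
    Real.sqrt (χ t₀) ≥ t₀ / 2 - 2 * (n : ℝ) + 2 / 3 - c / 3 + S 1 := by
  have hfc : Continuous f := by
    rw [show f = fun t => min t (min 1 (t₀ - t)) from funext hf]
    fun_prop
  have hI : ∀ a b : ℝ, IntervalIntegrable (fun t => f t ^ 2 * r t) MeasureTheory.volume a b :=
    fun a b => ((hfc.pow 2).mul hr).intervalIntegrable a b
  have hsplit : ∫ t in (0 : ℝ)..t₀, f t ^ 2 * r t =
      (∫ t in (0 : ℝ)..1, f t ^ 2 * r t) + (∫ t in (1 : ℝ)..(t₀ - 1), f t ^ 2 * r t) +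
        ∫ t in (t₀ - 1)..t₀, f t ^ 2 * r t := by
    rw [intervalIntegral.integral_add_adjacent_intervals (hI _ _) (hI _ _),
      intervalIntegral.integral_add_adjacent_intervals (hI _ _) (hI _ _)]
  have hfirst : -(c / 3) ≤ ∫ t in (0 : ℝ)..1, f t ^ 2 * r t := by
    have hlow : ∫ t in (0 : ℝ)..1, t ^ 2 * (-c) = -(c / 3) := by
      rw [intervalIntegral.integral_mul_const, integral_pow]
      norm_num
      ring
    rw [← hlow]
    refine intervalIntegral.integral_mono_on zero_le_one
      (Continuous.intervalIntegrable (by fun_prop) _ _) (hI _ _) fun t ht => ?_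
    have hft : f t = t := by
      rw [hf, min_eq_left (le_min ht.2 (by linarith [ht.2]))]
    rw [hft]
    exact mul_le_mul_of_nonneg_left (neg_le_of_abs_le (hrbd t ht)) (sq_nonneg t)
  have hmiddle : ∫ t in (1 : ℝ)..(t₀ - 1), f t ^ 2 * r t =
      (t₀ - 2) / 2 - S (t₀ - 1) + S 1 := by
    have hle : (1 : ℝ) ≤ t₀ - 1 := by linarith
    have hcongr : ∫ t in (1 : ℝ)..(t₀ - 1), f t ^ 2 * r t = ∫ t in (1 : ℝ)..(t₀ - 1), r t := by
      refine intervalIntegral.integral_congr fun t ht => ?_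
      rw [Set.uIcc_of_le hle] at ht
      have hft : f t = 1 := by
        rw [hf, min_eq_left (a := (1 : ℝ)) (by linarith [ht.2]), min_eq_right ht.1]
      simp [hft]
    have hftc : ∫ t in (1 : ℝ)..(t₀ - 1), r t =
        ((t₀ - 1) / 2 - S (t₀ - 1)) - (1 / 2 - S 1) := by
      refine intervalIntegral.integral_eq_sub_of_hasDerivAt (f := fun t => t / 2 - S t)
        (fun t ht => ?_) (hr.intervalIntegrable _ _)
      rw [Set.uIcc_of_le hle] at ht
      refine (((hasDerivAt_id t).div_const 2).sub
        (hS t ⟨by linarith [ht.1], by linarith [ht.2]⟩)).congr_deriv ?_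
      ring
    rw [hcongr, hftc]
    ring
  have hlast : 1 / 6 + S (t₀ - 1) - (Real.sqrt (χ t₀) + 1 / 2) ≤
      ∫ t in (t₀ - 1)..t₀, f t ^ 2 * r t := by
    have hle : t₀ - 1 ≤ t₀ := by linarith
    set M := Real.sqrt (χ t₀) + 1 / 2 with hM
    have hSM : ∀ t ∈ Set.Icc (t₀ - 1) t₀, S t ≤ M := fun t ht => by
      have h1 := (le_abs_self _).trans (hSχ t ht)
      have h2 := (le_abs_self _).trans (hχlip t ht t₀ ⟨hle, le_rfl⟩)
      have h3 : |t - t₀| ≤ 1 := abs_le.2 ⟨by linarith [ht.1], by linarith [ht.2]⟩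
      linarith
    have hSc : ContinuousOn S (Set.uIcc (t₀ - 1) t₀) := fun t ht => by
      rw [Set.uIcc_of_le hle] at ht
      exact (hS t ⟨by linarith [ht.1], ht.2⟩).continuousAt.continuousWithinAt
    have hftc : ∫ t in (t₀ - 1)..t₀, ((t₀ - t) ^ 2 * r t + 2 * (t₀ - t) * (S t - M)) =
        1 / 6 + S (t₀ - 1) - M := by
      rw [intervalIntegral.integral_eq_sub_of_hasDerivAt
        (f := fun t => -((t₀ - t) ^ 3 / 6) - (t₀ - t) ^ 2 * (S t - M))]
      · ring
      · intro t ht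
        rw [Set.uIcc_of_le hle] at ht
        have hd : HasDerivAt (fun t => t₀ - t) (-1) t := (hasDerivAt_id t).const_sub t₀
        refine ((((hd.pow 3).div_const 6).neg).sub ((hd.pow 2).mul
          ((hS t ⟨by linarith [ht.1], ht.2⟩).sub_const M))).congr_deriv ?_
        simp only [Pi.pow_apply]
        norm_num
        ring
      · exact ContinuousOn.intervalIntegrable (by fun_prop)
    rw [← hftc]
    refine intervalIntegral.integral_mono_on hle
      (ContinuousOn.intervalIntegrable (by fun_prop)) (hI _ _) fun t ht => ?_
    have hft : f t = t₀ - t := by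
      rw [hf, min_eq_right (a := (1 : ℝ)) (by linarith [ht.1]),
        min_eq_right (by linarith [ht.1])]
    rw [hft]
    nlinarith [mul_nonneg (sub_nonneg.2 ht.2) (sub_nonneg.2 (hSM t ht))]
  linarith
end
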